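/- arXiv:0910.2608 — 2 statements merged into one kernel-verified Lean document; each statement's English description precedes it below -/
import Mathlib

section
/- For all integers k ≥ 3 and N ≥ 1, there is a bijection between the set of k-noncrossing set partitions of [N] and the set of k-noncrossing braids over [N−1]; in particular these two sets have the same cardinality. -/
/-- `i` and `j` lie in a common block of the partition `P`. -/
def SameBlock {N : ℕ} (P : Finpartition (Finset.univ : Finset (Fin N))) (i j : Fin N) : Prop :=
  ∃ B ∈ P.parts, i ∈ B ∧ j ∈ B

/-- `(i,j)` is an arc of the standard representation of the partition `P`:
`i < j` lie in a common block with no element of that block strictly between them. -/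
def IsArc {N : ℕ} (P : Finpartition (Finset.univ : Finset (Fin N))) (i j : Fin N) : Prop :=
  i < j ∧ SameBlock P i j ∧ ∀ l : Fin N, i < l → l < j → ¬ SameBlock P i l

/-- The partition `P` has a `k`-crossing: arcs `(i₁,j₁),…,(i_k,j_k)` with
`i₁ < … < i_k < j₁ < … < j_k`. -/
def PartitionHasKCrossing {N : ℕ} (k : ℕ)
    (P : Finpartition (Finset.univ : Finset (Fin N))) : Prop :=
  ∃ a b : Fin k → Fin N, StrictMono a ∧ StrictMono b ∧
    (∀ m, IsArc P (a m) (b m)) ∧ ∀ m m', a m < b m'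

/-- A `k`-noncrossing set partition. -/
def IsKNoncrossingPartition {N : ℕ} (k : ℕ)
    (P : Finpartition (Finset.univ : Finset (Fin N))) : Prop :=
  ¬ PartitionHasKCrossing k P

/-- A `2`-regular partition: distinct elements of a common block differ by at least `2`. -/
def IsTwoRegular {N : ℕ} (P : Finpartition (Finset.univ : Finset (Fin N))) : Prop :=
  ∀ i j : Fin N, SameBlock P i j → i ≠ j → 2 ≤ |(i : ℤ) - (j : ℤ)|

/-- A braid over `[M]`, given as its finite set of arcs `(i,j)` with `i ≤ j`:
every vertex is the smaller endpoint of at most one arc and the larger endpoint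
of at most one arc. -/
def IsBraid {M : ℕ} (B : Finset (Fin M × Fin M)) : Prop :=
  (∀ p ∈ B, p.1 ≤ p.2) ∧
  (∀ p ∈ B, ∀ q ∈ B, p.1 = q.1 → p = q) ∧
  (∀ p ∈ B, ∀ q ∈ B, p.2 = q.2 → p = q)

/-- The braid `B` has a `k`-crossing: arcs `(i₁,j₁),…,(i_k,j_k)` with
`i₁ < … < i_k ≤ j₁ < … < j_k`. -/
def BraidHasKCrossing {M : ℕ} (k : ℕ) (B : Finset (Fin M × Fin M)) : Prop :=
  ∃ a b : Fin k → Fin M, StrictMono a ∧ StrictMono b ∧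
    (∀ m, (a m, b m) ∈ B) ∧ ∀ m m', a m ≤ b m'

/-- A `k`-noncrossing braid. -/
def IsKNoncrossingBraid {M : ℕ} (k : ℕ) (B : Finset (Fin M × Fin M)) : Prop :=
  IsBraid B ∧ ¬ BraidHasKCrossing k B

/-- The braid `B` contains a loop `(i,i)`. -/
def HasLoop {M : ℕ} (B : Finset (Fin M × Fin M)) : Prop := ∃ i, (i, i) ∈ B

section SameBlock

variable {N : ℕ} {P Q : Finpartition (Finset.univ : Finset (Fin N))} {i j l : Fin N}

theorem sameBlock_iff_mem_part : SameBlock P i j ↔ j ∈ P.part i :=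
  ⟨fun ⟨B, hB, hi, hj⟩ => P.mem_part_iff_exists.2 ⟨B, hB, hj, hi⟩, fun h =>
    let ⟨B, hB, hj, hi⟩ := P.mem_part_iff_exists.1 h
    ⟨B, hB, hi, hj⟩⟩

theorem SameBlock.trans (h : SameBlock P i j) (h' : SameBlock P j l) : SameBlock P i l := by
  obtain ⟨B, hB, hi, hj⟩ := h
  obtain ⟨C, hC, hj', hl⟩ := h'
  obtain rfl := P.eq_of_mem_parts hB hC hj hj'
  exact ⟨B, hB, hi, hl⟩

theorem SameBlock.symm (h : SameBlock P i j) : SameBlock P j i := by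
  obtain ⟨B, hB, hi, hj⟩ := h
  exact ⟨B, hB, hj, hi⟩

theorem SameBlock.refl (P : Finpartition (Finset.univ : Finset (Fin N))) (i : Fin N) :
    SameBlock P i i :=
  sameBlock_iff_mem_part.2 (P.mem_part (Finset.mem_univ i))

/-- A partition is determined by the relation of lying in a common block. -/
theorem eq_of_sameBlock_iff (h : ∀ i j, SameBlock P i j ↔ SameBlock Q i j) : P = Q := by
  have hpart : ∀ i, P.part i = Q.part i := fun i => by
    ext j
    rw [← sameBlock_iff_mem_part, ← sameBlock_iff_mem_part, h]
  have hsub : ∀ P Q : Finpartition (Finset.univ : Finset (Fin N)),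
      (∀ i, P.part i = Q.part i) → P.parts ⊆ Q.parts := fun P Q hPQ B hB => by
    obtain ⟨i, hi⟩ := P.nonempty_of_mem_parts hB
    rw [← P.part_eq_of_mem hB hi, hPQ]
    exact Q.part_mem.2 (Finset.mem_univ i)
  exact Finpartition.ext
    (Finset.Subset.antisymm (hsub P Q hpart) (hsub Q P fun i => (hpart i).symm))

/-- Comparable elements of a common block are joined by a path of arcs. -/
theorem SameBlock.reflTransGen_isArc (h : SameBlock P i j) (hij : i ≤ j) :
    Relation.ReflTransGen (IsArc P) i j := by
  induction hn : (j : ℕ) - i using Nat.strong_induction_on generalizing i j with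
  | _ n ih =>
    rcases hij.eq_or_lt with rfl | hlt
    · exact .refl
    by_cases hl : ∃ l, i < l ∧ l < j ∧ SameBlock P i l
    · obtain ⟨l, hil, hlj, hs⟩ := hl
      exact (ih (l - i) (by omega) hs hil.le rfl).trans
        (ih (j - l) (by omega) (hs.symm.trans h) hlj.le rfl)
    · exact .single ⟨hlt, h, fun l h₁ h₂ h₃ => hl ⟨l, h₁, h₂, h₃⟩⟩

theorem sameBlock_of_reflTransGen (h : Relation.ReflTransGen (IsArc P) i j) :
    SameBlock P i j := by
  induction h with
  | refl => exact .refl P i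
  | tail _ h ih => exact ih.trans h.2.1

/-- A partition is determined by its arcs. -/
theorem eq_of_isArc_iff (h : ∀ i j, IsArc P i j ↔ IsArc Q i j) : P = Q := by
  have hR : IsArc P = IsArc Q := by
    ext i j
    exact h i j
  have key : ∀ P Q : Finpartition (Finset.univ : Finset (Fin N)), IsArc P = IsArc Q →
      ∀ i j, SameBlock P i j → SameBlock Q i j := fun P Q hPQ i j hs => by
    rcases le_total i j with hij | hij
    · exact sameBlock_of_reflTransGen (hPQ ▸ hs.reflTransGen_isArc hij)
    · exact (sameBlock_of_reflTransGen (hPQ ▸ hs.symm.reflTransGen_isArc hij)).symm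
  exact eq_of_sameBlock_iff fun i j => ⟨key P Q hR i j, key Q P hR.symm i j⟩

theorem IsArc.right_unique (h : IsArc P i j) (h' : IsArc P i l) : j = l := by
  rcases lt_trichotomy j l with hlt | rfl | hlt
  · exact (h'.2.2 j h.1 hlt h.2.1).elim
  · rfl
  · exact (h.2.2 l h'.1 hlt h'.2.1).elim

theorem IsArc.left_unique (h : IsArc P i l) (h' : IsArc P j l) : i = j := by
  have hs : SameBlock P i j := h.2.1.trans h'.2.1.symm
  rcases lt_trichotomy i j with hlt | rfl | hlt
  · exact (h.2.2 j hlt h'.1 hs).elim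
  · rfl
  · exact (h'.2.2 i hlt h.1 hs.symm).elim

end SameBlock

/-- An increasing relation that is a partial injection is the arc relation of some partition. -/
theorem exists_isArc_iff {N : ℕ} {R : Fin N → Fin N → Prop} (hlt : ∀ i j, R i j → i < j)
    (hright : Relator.RightUnique R) (hleft : Relator.LeftUnique R) :
    ∃ P : Finpartition (Finset.univ : Finset (Fin N)), ∀ i j, IsArc P i j ↔ R i j := by
  classical
  have hle : ∀ {i j}, Relation.ReflTransGen R i j → i ≤ j := fun {i j} h => by
    induction h with
    | refl => exact le_rfl
    | tail _ h ih => exact ih.trans (hlt _ _ h).le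
  have hright' : Relator.RightUnique (Function.swap R) := fun _ _ _ h h' => hleft h h'
  let s : Setoid (Fin N) :=
    { r := fun i j => Relation.ReflTransGen R i j ∨ Relation.ReflTransGen R j i
      iseqv :=
        { refl := fun _ => .inl .refl
          symm := fun h => h.symm
          trans := by
            rintro x y z (h | h) (h' | h')
            · exact .inl (h.trans h')
            · have := Relation.ReflTransGen.total_of_right_unique hright'
                (Relation.reflTransGen_swap.2 h) (Relation.reflTransGen_swap.2 h')
              simpa only [Relation.reflTransGen_swap, or_comm] using this
            · exact Relation.ReflTransGen.total_of_right_unique hright h h'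
            · exact .inr (h'.trans h) } }
  have hs : ∀ i j, SameBlock (Finpartition.ofSetoid s) i j ↔
      Relation.ReflTransGen R i j ∨ Relation.ReflTransGen R j i := fun i j => by
    rw [sameBlock_iff_mem_part, Finpartition.mem_part_ofSetoid_iff_rel]
    rfl
  have hs' : ∀ {i j}, i < j → SameBlock (Finpartition.ofSetoid s) i j →
      ∃ c, R i c ∧ c ≤ j ∧ Relation.ReflTransGen R i c := fun {i j} hij h => by
    have h : Relation.ReflTransGen R i j :=
      ((hs i j).1 h).resolve_right fun h => (hle h).not_gt hij
    rcases h.cases_head with rfl | ⟨c, hc, hcj⟩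
    · exact (lt_irrefl _ hij).elim
    · exact ⟨c, hc, hle hcj, .single hc⟩
  refine ⟨Finpartition.ofSetoid s, fun i j => ⟨fun ⟨hij, hsame, hno⟩ => ?_, fun h => ?_⟩⟩
  · obtain ⟨c, hc, hcj, hic⟩ := hs' hij hsame
    rcases hcj.eq_or_lt with rfl | hcj
    · exact hc
    · exact (hno c (hlt _ _ hc) hcj ((hs i c).2 (.inl hic))).elim
  · refine ⟨hlt _ _ h, (hs i j).2 (.inl (.single h)), fun l hil hlj hsame => ?_⟩
    obtain ⟨c, hc, hcl, -⟩ := hs' hil hsame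
    obtain rfl := hright hc h
    exact hcl.not_gt hlj

section BraidOfPartition

variable {M : ℕ}

open Classical in
/-- The braid obtained from a partition by moving the larger endpoint of every arc
one step to the left. -/
noncomputable def braidOfPartition (P : Finpartition (Finset.univ : Finset (Fin (M + 1)))) :
    Finset (Fin M × Fin M) :=
  Finset.univ.filter fun p => IsArc P p.1.castSucc p.2.succ

variable {P : Finpartition (Finset.univ : Finset (Fin (M + 1)))}

theorem mem_braidOfPartition {p : Fin M × Fin M} :
    p ∈ braidOfPartition P ↔ IsArc P p.1.castSucc p.2.succ := by
  simp [braidOfPartition]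

theorem isArc_iff_exists_mem_braidOfPartition {i j : Fin (M + 1)} :
    IsArc P i j ↔ ∃ p ∈ braidOfPartition P, p.1.castSucc = i ∧ p.2.succ = j := by
  constructor
  · intro h
    obtain ⟨a, rfl⟩ := Fin.exists_castSucc_eq.2 (Fin.ne_last_of_lt h.1)
    obtain ⟨b, rfl⟩ := Fin.exists_succ_eq.2 (Fin.ne_zero_of_lt h.1)
    exact ⟨(a, b), mem_braidOfPartition.2 h, rfl, rfl⟩
  · rintro ⟨p, hp, rfl, rfl⟩
    exact mem_braidOfPartition.1 hp

theorem isBraid_braidOfPartition : IsBraid (braidOfPartition P) := by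
  refine ⟨fun p hp => ?_, fun p hp q hq h => Prod.ext h ?_, fun p hp q hq h => Prod.ext ?_ h⟩
  · exact Fin.castSucc_lt_succ_iff.1 (mem_braidOfPartition.1 hp).1
  · rw [mem_braidOfPartition] at hp hq
    exact Fin.succ_injective _ (hp.right_unique (h ▸ hq))
  · rw [mem_braidOfPartition] at hp hq
    exact Fin.castSucc_injective _ (hp.left_unique (h ▸ hq))

theorem braidHasKCrossing_braidOfPartition {k : ℕ} :
    BraidHasKCrossing k (braidOfPartition P) ↔ PartitionHasKCrossing k P := by
  constructor
  · rintro ⟨a, b, ha, hb, hmem, hab⟩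
    exact ⟨fun m => (a m).castSucc, fun m => (b m).succ, fun _ _ h => ha h,
      fun _ _ h => Fin.succ_lt_succ_iff.2 (hb h), fun m => mem_braidOfPartition.1 (hmem m),
      fun m m' => Fin.castSucc_lt_succ_iff.2 (hab m m')⟩
  · rintro ⟨a, b, ha, hb, harc, hab⟩
    choose p hp hpa hpb using fun m => isArc_iff_exists_mem_braidOfPartition.1 (harc m)
    obtain rfl : (fun m => (p m).1.castSucc) = a := funext hpa
    obtain rfl : (fun m => (p m).2.succ) = b := funext hpb
    exact ⟨fun m => (p m).1, fun m => (p m).2, fun _ _ h => ha h,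
      fun _ _ h => Fin.succ_lt_succ_iff.1 (hb h), hp,
      fun m m' => Fin.castSucc_lt_succ_iff.1 (hab m m')⟩

theorem braidOfPartition_injective : Function.Injective (braidOfPartition (M := M)) :=
  fun P Q h => eq_of_isArc_iff fun i j => by
    rw [isArc_iff_exists_mem_braidOfPartition, isArc_iff_exists_mem_braidOfPartition, h]

theorem exists_braidOfPartition_eq {B : Finset (Fin M × Fin M)} (hB : IsBraid B) :
    ∃ P, braidOfPartition P = B := by
  obtain ⟨hle, hfst, hsnd⟩ := hB
  obtain ⟨P, hP⟩ := exists_isArc_iff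
    (R := fun i j => ∃ p ∈ B, p.1.castSucc = i ∧ p.2.succ = j) (by
      rintro _ _ ⟨p, hp, rfl, rfl⟩
      exact Fin.castSucc_lt_succ_iff.2 (hle p hp)) (by
      rintro _ _ _ ⟨p, hp, rfl, rfl⟩ ⟨q, hq, h, rfl⟩
      rw [hfst q hq p hp (Fin.castSucc_injective _ h)]) (by
      rintro _ _ _ ⟨p, hp, rfl, rfl⟩ ⟨q, hq, rfl, h⟩
      rw [hsnd q hq p hp (Fin.succ_injective _ h)])
  refine ⟨P, Finset.ext fun p => ?_⟩
  rw [mem_braidOfPartition, hP]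
  constructor
  · rintro ⟨q, hq, h₁, h₂⟩
    rwa [← Prod.ext (Fin.castSucc_injective _ h₁) (Fin.succ_injective _ h₂)]
  · exact fun hp => ⟨p, hp, rfl, rfl⟩

/-- Moving the larger endpoints of arcs one step to the left is a bijection from `k`-noncrossing
partitions to `k`-noncrossing braids. -/
noncomputable def noncrossingPartitionEquivBraid (k M : ℕ) :
    {P : Finpartition (Finset.univ : Finset (Fin (M + 1))) // IsKNoncrossingPartition k P}
      ≃ {B : Finset (Fin M × Fin M) // IsKNoncrossingBraid k B} :=
  Equiv.ofBijective
    (fun P => ⟨braidOfPartition P.1, isBraid_braidOfPartition,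
      fun h => P.2 (braidHasKCrossing_braidOfPartition.1 h)⟩)
    ⟨fun _ _ h => Subtype.ext (braidOfPartition_injective (congrArg Subtype.val h)),
      fun ⟨B, hB, hk⟩ => by
        obtain ⟨P, rfl⟩ := exists_braidOfPartition_eq hB
        exact ⟨⟨P, fun h => hk (braidHasKCrossing_braidOfPartition.2 h)⟩, rfl⟩⟩

end BraidOfPartition

/-- For `k ≥ 3` and `N ≥ 1`, there is a bijection between `k`-noncrossing set
partitions of `[N]` and `k`-noncrossing braids over `[N-1]`; in particular the
two sets have the same cardinality. -/
theorem partitions_equiv_braids (k N : ℕ) (hk : 3 ≤ k) (hN : 1 ≤ N) :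
    Nonempty
      ({P : Finpartition (Finset.univ : Finset (Fin N)) // IsKNoncrossingPartition k P}
        ≃ {B : Finset (Fin (N - 1) × Fin (N - 1)) // IsKNoncrossingBraid k B}) ∧
    Nat.card {P : Finpartition (Finset.univ : Finset (Fin N)) // IsKNoncrossingPartition k P}
      = Nat.card {B : Finset (Fin (N - 1) × Fin (N - 1)) // IsKNoncrossingBraid k B} := by
  obtain ⟨M, rfl⟩ := Nat.exists_eq_add_of_le' hN
  exact ⟨⟨noncrossingPartitionEquivBraid k M⟩, Nat.card_congr (noncrossingPartitionEquivBraid k M)⟩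
end

section
/- For every integer ℓ ≥ 0 and every point (i,j) with i > j ≥ 0, the number of B*_{W2}-walks of length 2ℓ ending at (i,j) satisfies σ*^{i,j}_{2ℓ} = Σ_{h=0}^{ℓ} (−1)^h · C(ℓ,h) · ω^{i,j}_{2(ℓ−h)+1}, where C(ℓ,h) is the binomial coefficient. -/
/-- The quarter plane `Q₂ = {(a,b) : a ≥ 0, b ≥ 0}`. -/
def Q2 : Set (ℤ × ℤ) := {p | 0 ≤ p.1 ∧ 0 ≤ p.2}

/-- The Weyl chamber `W₂ = {(a,b) : a > b ≥ 0}`. -/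
def W2 : Set (ℤ × ℤ) := {p | p.2 < p.1 ∧ 0 ≤ p.2}

/-- A "down" step: `(-1,0)`, `(0,-1)` or `(0,0)`. -/
def DownStep (d : ℤ × ℤ) : Prop := d = (-1, 0) ∨ d = (0, -1) ∨ d = (0, 0)

/-- An "up" step: `(1,0)`, `(0,1)` or `(0,0)`. -/
def UpStep (d : ℤ × ℤ) : Prop := d = (1, 0) ∨ d = (0, 1) ∨ d = (0, 0)

/-- A `𝒫_D`-walk of length `s`: starts at `(1,0)`, stays in `D`, odd steps are
down steps, even steps are up steps.  (The walk is encoded as a function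
`ℕ → ℤ × ℤ` which is constant from index `s` on.) -/
def IsPWalk (D : Set (ℤ × ℤ)) (s : ℕ) (w : ℕ → ℤ × ℤ) : Prop :=
  w 0 = (1, 0) ∧ (∀ r ≤ s, w r ∈ D) ∧
  (∀ r, 1 ≤ r → r ≤ s → r % 2 = 1 → DownStep (w r - w (r - 1))) ∧
  (∀ r, 1 ≤ r → r ≤ s → r % 2 = 0 → UpStep (w r - w (r - 1))) ∧
  (∀ r, s ≤ r → w r = w s)

/-- A `ℬ_D`-walk of length `s`: starts at `(1,0)`, stays in `D`, odd steps are
up steps, even steps are down steps. -/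
def IsBWalk (D : Set (ℤ × ℤ)) (s : ℕ) (w : ℕ → ℤ × ℤ) : Prop :=
  w 0 = (1, 0) ∧ (∀ r ≤ s, w r ∈ D) ∧
  (∀ r, 1 ≤ r → r ≤ s → r % 2 = 1 → UpStep (w r - w (r - 1))) ∧
  (∀ r, 1 ≤ r → r ≤ s → r % 2 = 0 → DownStep (w r - w (r - 1))) ∧
  (∀ r, s ≤ r → w r = w s)

/-- `a^{i,j}_s`: the number of `𝒫_{Q₂}`-walks of length `s` ending at `p`. -/
noncomputable def aQ (s : ℕ) (p : ℤ × ℤ) : ℕ :=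
  Nat.card {w : ℕ → ℤ × ℤ // IsPWalk Q2 s w ∧ w s = p}

/-- `ω^{i,j}_s`: the number of `𝒫_{W₂}`-walks of length `s` ending at `p`. -/
noncomputable def omegaW (s : ℕ) (p : ℤ × ℤ) : ℕ :=
  Nat.card {w : ℕ → ℤ × ℤ // IsPWalk W2 s w ∧ w s = p}

/-- `σ^{i,j}_s`: the number of `ℬ_{W₂}`-walks of length `s` ending at `p`. -/
noncomputable def sigmaB (s : ℕ) (p : ℤ × ℤ) : ℕ :=
  Nat.card {w : ℕ → ℤ × ℤ // IsBWalk W2 s w ∧ w s = p}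

/-- No index `q ≥ 1` with steps `w_{2q-1} - w_{2q-2} = (1,0)` and
`w_{2q} - w_{2q-1} = (-1,0)`. -/
def NoUpDownPair (s : ℕ) (w : ℕ → ℤ × ℤ) : Prop :=
  ∀ q, 1 ≤ q → 2 * q ≤ s →
    ¬ (w (2 * q - 1) - w (2 * q - 2) = (1, 0) ∧ w (2 * q) - w (2 * q - 1) = (-1, 0))

/-- A `ℬ*_{W₂}`-walk. -/
def IsBStarWalk (s : ℕ) (w : ℕ → ℤ × ℤ) : Prop :=
  IsBWalk W2 s w ∧ NoUpDownPair s w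

/-- `σ*^{i,j}_s`: the number of `ℬ*_{W₂}`-walks of length `s` ending at `p`. -/
noncomputable def sigmaStar (s : ℕ) (p : ℤ × ℤ) : ℕ :=
  Nat.card {w : ℕ → ℤ × ℤ // IsBStarWalk s w ∧ w s = p}

/-- The nine pairs consisting of an up step followed by a down step. -/
def upDownPairs : Finset ((ℤ × ℤ) × (ℤ × ℤ)) :=
  ({(1, 0), (0, 1), (0, 0)} : Finset (ℤ × ℤ)) ×ˢ {(-1, 0), (0, -1), (0, 0)}

/-- A walk of length `2 * n` in `W2` from `(1,0)` whose consecutive pairs of steps lie in `S`. -/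
def IsPairWalk (S : Finset ((ℤ × ℤ) × (ℤ × ℤ))) (n : ℕ) (w : ℕ → ℤ × ℤ) : Prop :=
  w 0 = (1, 0) ∧ (∀ r ≤ 2 * n, w r ∈ W2) ∧
  (∀ k < n, (w (2 * k + 1) - w (2 * k), w (2 * k + 2) - w (2 * k + 1)) ∈ S) ∧
  (∀ r, 2 * n ≤ r → w r = w (2 * n))

/-- The pair walks of length `2 * n` ending at `p`. -/
abbrev PairWalk (S : Finset ((ℤ × ℤ) × (ℤ × ℤ))) (n : ℕ) (p : ℤ × ℤ) : Type :=
  {w : ℕ → ℤ × ℤ // IsPairWalk S n w ∧ w (2 * n) = p}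

/-- Append a pair of steps, passing through `q` and ending at `p`, to a walk of length `2 * n`. -/
def appendPair (n : ℕ) (q p : ℤ × ℤ) (w : ℕ → ℤ × ℤ) (r : ℕ) : ℤ × ℤ :=
  if r ≤ 2 * n then w r else if r = 2 * n + 1 then q else p

lemma mem_upDownPairs (u d : ℤ × ℤ) : (u, d) ∈ upDownPairs ↔ UpStep u ∧ DownStep d := by
  simp [upDownPairs, UpStep, DownStep]

lemma IsPairWalk.appendPair {S : Finset ((ℤ × ℤ) × (ℤ × ℤ))} {n : ℕ} {w : ℕ → ℤ × ℤ}
    (hw : IsPairWalk S n w) {q p : ℤ × ℤ} (hq : q ∈ W2) (hp : p ∈ W2)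
    (hS : (q - w (2 * n), p - q) ∈ S) : IsPairWalk S (n + 1) (appendPair n q p w) := by
  obtain ⟨h0, hW, hs, -⟩ := hw
  refine ⟨by simpa [_root_.appendPair] using h0, fun r _ ↦ ?_, fun k hk ↦ ?_, fun r hr ↦ ?_⟩
  · unfold _root_.appendPair
    split_ifs with h
    exacts [hW r h, hq, hp]
  · rcases Nat.lt_succ_iff_lt_or_eq.mp hk with h | rfl
    · have h1 : 2 * k ≤ 2 * n := by omega
      have h2 : 2 * k + 1 ≤ 2 * n := by omega
      have h3 : 2 * k + 2 ≤ 2 * n := by omega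
      simpa only [_root_.appendPair, h1, h2, h3, if_true] using hs k h
    · simpa [_root_.appendPair] using hS
  · have h1 : ¬ r ≤ 2 * n := by omega
    have h2 : ¬ r = 2 * n + 1 := by omega
    have h3 : ¬ 2 * (n + 1) ≤ 2 * n := by omega
    have h4 : ¬ 2 * (n + 1) = 2 * n + 1 := by omega
    simp only [_root_.appendPair, h1, h2, h3, h4, if_false]

lemma IsPairWalk.truncate {S : Finset ((ℤ × ℤ) × (ℤ × ℤ))} {n : ℕ} {w : ℕ → ℤ × ℤ}
    (hw : IsPairWalk S (n + 1) w) : IsPairWalk S n (fun r ↦ w (min r (2 * n))) := by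
  obtain ⟨h0, hW, hs, -⟩ := hw
  refine ⟨by simpa using h0, fun r _ ↦ hW _ (by omega), fun k hk ↦ ?_, fun r hr ↦ ?_⟩
  · have h1 : min (2 * k) (2 * n) = 2 * k := by omega
    have h2 : min (2 * k + 1) (2 * n) = 2 * k + 1 := by omega
    have h3 : min (2 * k + 2) (2 * n) = 2 * k + 2 := by omega
    simpa only [h1, h2, h3] using hs k (by omega)
  · simp [hr]

lemma IsPairWalk.appendPair_truncate {S : Finset ((ℤ × ℤ) × (ℤ × ℤ))} {n : ℕ} {w : ℕ → ℤ × ℤ}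
    (hw : IsPairWalk S (n + 1) w) :
    _root_.appendPair n (w (2 * n + 1)) (w (2 * n + 2)) (fun r ↦ w (min r (2 * n))) = w := by
  funext r
  unfold _root_.appendPair
  split_ifs with h1 h2
  · simp [h1]
  · rw [h2]
  · exact (hw.2.2.2 r (by omega)).symm

/-- Pair walks of length `2 * n + 2` are decomposed according to their last pair of steps. -/
lemma exists_pairWalk_succ_equiv (S : Finset ((ℤ × ℤ) × (ℤ × ℤ))) (n : ℕ) (p : ℤ × ℤ) :
    Nonempty ((Σ s : S, {w : PairWalk S n (p - s.1.2 - s.1.1) // p ∈ W2 ∧ p - s.1.2 ∈ W2}) ≃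
      PairWalk S (n + 1) p) := by
  have h1 : ¬ 2 * (n + 1) ≤ 2 * n := by omega
  have h2 : ¬ 2 * (n + 1) = 2 * n + 1 := by omega
  refine ⟨Equiv.ofBijective (fun x ↦ ⟨appendPair n (p - x.1.1.2) p x.2.1.1,
    x.2.1.2.1.appendPair x.2.2.2 x.2.2.1 ?_, ?_⟩) ⟨?_, ?_⟩⟩
  · rw [x.2.1.2.2]
    simp
  · simp only [appendPair, h1, h2, if_false]
  · rintro ⟨⟨⟨u, d⟩, hs⟩, ⟨⟨w, hw, hwp⟩, hW⟩⟩ ⟨⟨⟨u', d'⟩, hs'⟩, ⟨⟨w', hw', hwp'⟩, hW'⟩⟩ h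
    have h := Subtype.ext_iff.mp h
    dsimp only at h hwp hwp'
    have hd : d = d' := by simpa [appendPair] using congrFun h (2 * n + 1)
    subst hd
    have he : ∀ r ≤ 2 * n, w r = w' r := fun r hr ↦ by
      simpa [appendPair, hr] using congrFun h r
    have hu : u = u' := by
      have := he _ le_rfl
      rw [hwp, hwp'] at this
      simpa using this
    subst hu
    have : w = w' := by
      funext r
      rcases le_total r (2 * n) with hr | hr
      · exact he r hr
      · rw [hw.2.2.2 r hr, hw'.2.2.2 r hr, hwp, hwp']
    subst this
    rfl
  · rintro ⟨w, hw, rfl⟩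
    have hq : w (2 * (n + 1)) - (w (2 * n + 2) - w (2 * n + 1)) = w (2 * n + 1) := by
      rw [mul_add, mul_one]
      abel
    refine ⟨⟨⟨_, hw.2.2.1 n (by omega)⟩, ⟨⟨_, hw.truncate, ?_⟩, hw.2.1 _ (by omega), ?_⟩⟩, ?_⟩
    · dsimp only
      rw [hq]
      simp
    · dsimp only
      rw [hq]
      exact hw.2.1 _ (by omega)
    · apply Subtype.ext
      dsimp only
      rw [hq]
      exact hw.appendPair_truncate

lemma IsPairWalk.zero_iff (S : Finset ((ℤ × ℤ) × (ℤ × ℤ))) (w : ℕ → ℤ × ℤ) :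
    IsPairWalk S 0 w ↔ w = fun _ ↦ (1, 0) := by
  constructor
  · rintro ⟨h0, -, -, h⟩
    funext r
    rw [h r (by omega), mul_zero, h0]
  · rintro rfl
    exact ⟨rfl, fun _ _ ↦ by simp [W2], fun k hk ↦ absurd hk (by omega), fun _ _ ↦ rfl⟩

instance PairWalk.finite (S : Finset ((ℤ × ℤ) × (ℤ × ℤ))) (n : ℕ) (p : ℤ × ℤ) :
    Finite (PairWalk S n p) := by
  induction n generalizing p with
  | zero =>
    have : Subsingleton (PairWalk S 0 p) := ⟨fun a b ↦ Subtype.ext <| by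
      rw [(IsPairWalk.zero_iff S _).mp a.2.1, (IsPairWalk.zero_iff S _).mp b.2.1]⟩
    infer_instance
  | succ n ih =>
    obtain ⟨e⟩ := exists_pairWalk_succ_equiv S n p
    exact Finite.of_equiv _ e

open Classical in
/-- The transfer operator of the pairs of steps in `S`. -/
noncomputable def pairTransfer (S : Finset ((ℤ × ℤ) × (ℤ × ℤ))) :
    Module.End ℤ (ℤ × ℤ → ℤ) where
  toFun f p := ∑ s ∈ S, if p ∈ W2 ∧ p - s.2 ∈ W2 then f (p - s.2 - s.1) else 0
  map_add' f g := by
    funext p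
    simp only [Pi.add_apply, ← Finset.sum_add_distrib]
    refine Finset.sum_congr rfl fun s _ ↦ ?_
    split_ifs <;> simp
  map_smul' c f := by
    funext p
    simp only [Pi.smul_apply, smul_eq_mul, Finset.mul_sum, RingHom.id_apply, mul_ite, mul_zero]

/-- The number of pair walks, as a function of the endpoint. -/
noncomputable def pairWalkCount (S : Finset ((ℤ × ℤ) × (ℤ × ℤ))) (n : ℕ) (p : ℤ × ℤ) : ℤ :=
  Nat.card (PairWalk S n p)

lemma pairWalkCount_succ (S : Finset ((ℤ × ℤ) × (ℤ × ℤ))) (n : ℕ) :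
    pairWalkCount S (n + 1) = pairTransfer S (pairWalkCount S n) := by
  classical
  funext p
  obtain ⟨e⟩ := exists_pairWalk_succ_equiv S n p
  simp only [pairWalkCount, pairTransfer, LinearMap.coe_mk, AddHom.coe_mk]
  rw [← Nat.card_congr e, Nat.card_sigma, Nat.cast_sum, ← Finset.sum_coe_sort S]
  refine Finset.sum_congr rfl fun s _ ↦ ?_
  split_ifs with h
  · exact congrArg _ (Nat.card_congr (Equiv.subtypeUnivEquiv fun _ ↦ h))
  · have : IsEmpty {w : PairWalk S n (p - s.1.2 - s.1.1) // p ∈ W2 ∧ p - s.1.2 ∈ W2} :=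
      ⟨fun w ↦ h w.2⟩
    simp

lemma pairWalkCount_zero (S S' : Finset ((ℤ × ℤ) × (ℤ × ℤ))) :
    pairWalkCount S 0 = pairWalkCount S' 0 := by
  funext p
  simp only [pairWalkCount, PairWalk, IsPairWalk.zero_iff]

lemma pairWalkCount_eq_zero (S : Finset ((ℤ × ℤ) × (ℤ × ℤ))) (n : ℕ) {p : ℤ × ℤ}
    (hp : p ∉ W2) : pairWalkCount S n p = 0 := by
  have : IsEmpty (PairWalk S n p) := ⟨fun w ↦ hp (w.2.2 ▸ w.2.1.2.1 _ le_rfl)⟩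
  simp [pairWalkCount]

/-- Removing the pair `(1,0), (-1,0)` subtracts the identity from the transfer operator. -/
lemma pairTransfer_erase {f : ℤ × ℤ → ℤ} (hf : ∀ p ∉ W2, f p = 0) :
    pairTransfer (upDownPairs.erase ((1, 0), (-1, 0))) f = (-1 + pairTransfer upDownPairs) f := by
  classical
  funext p
  have hmem : (((1, 0), (-1, 0)) : (ℤ × ℤ) × (ℤ × ℤ)) ∈ upDownPairs := by
    simp [upDownPairs]
  simp only [pairTransfer, LinearMap.add_apply, LinearMap.neg_apply, Module.End.one_apply,
    Pi.add_apply, Pi.neg_apply, LinearMap.coe_mk, AddHom.coe_mk]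
  rw [← Finset.add_sum_erase _ _ hmem]
  by_cases hp : p ∈ W2
  · have hq : p - (-1, 0) ∈ W2 := by
      simp only [W2, Set.mem_ofPred_eq, Prod.fst_sub, Prod.snd_sub] at hp ⊢
      omega
    have hr : p - (-1, 0) - (1, 0) = p := by ext <;> simp
    simp [hp, hq, hr]
  · simp [hp, hf p hp]

lemma pairWalkCount_eq_pow (n : ℕ) :
    pairWalkCount upDownPairs n =
      (pairTransfer upDownPairs ^ n) (pairWalkCount upDownPairs 0) := by
  induction n with
  | zero => simp
  | succ n ih => rw [pairWalkCount_succ, ih, pow_succ', Module.End.mul_apply]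

lemma pairWalkCount_erase_eq_pow (n : ℕ) :
    pairWalkCount (upDownPairs.erase ((1, 0), (-1, 0))) n =
      ((-1 + pairTransfer upDownPairs) ^ n) (pairWalkCount upDownPairs 0) := by
  induction n with
  | zero => simpa using pairWalkCount_zero _ _
  | succ n ih =>
    rw [pairWalkCount_succ, pairTransfer_erase fun p hp ↦ pairWalkCount_eq_zero _ n hp, ih,
      pow_succ', Module.End.mul_apply]

lemma isBWalk_iff_isPairWalk (n : ℕ) (w : ℕ → ℤ × ℤ) :
    IsBWalk W2 (2 * n) w ↔ IsPairWalk upDownPairs n w := by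
  simp only [IsBWalk, IsPairWalk, mem_upDownPairs]
  refine and_congr_right fun _ ↦ and_congr_right fun _ ↦ ?_
  rw [← and_assoc]
  refine and_congr_left fun _ ↦ ⟨fun ⟨hu, hd⟩ k hk ↦ ?_, fun h ↦ ⟨fun r h1 hr hm ↦ ?_,
    fun r h1 hr hm ↦ ?_⟩⟩
  · exact ⟨hu (2 * k + 1) (by omega) (by omega) (by omega),
      hd (2 * k + 2) (by omega) (by omega) (by omega)⟩
  · obtain ⟨k, rfl⟩ : ∃ k, r = 2 * k + 1 := ⟨r / 2, by omega⟩
    exact (h k (by omega)).1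
  · obtain ⟨k, rfl⟩ : ∃ k, r = 2 * k + 2 := ⟨r / 2 - 1, by omega⟩
    exact (h k (by omega)).2

lemma isBStarWalk_iff_isPairWalk (n : ℕ) (w : ℕ → ℤ × ℤ) :
    IsBStarWalk (2 * n) w ↔ IsPairWalk (upDownPairs.erase ((1, 0), (-1, 0))) n w := by
  have hpair : NoUpDownPair (2 * n) w ↔ ∀ k < n,
      (w (2 * k + 1) - w (2 * k), w (2 * k + 2) - w (2 * k + 1)) ≠ ((1, 0), (-1, 0)) := by
    refine ⟨fun h k hk he ↦ h (k + 1) (by omega) (by omega) (Prod.mk_inj.mp he),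
      fun h q h1 hq ↦ ?_⟩
    obtain ⟨k, rfl⟩ : ∃ k, q = k + 1 := ⟨q - 1, by omega⟩
    exact fun he ↦ h k (by omega) (Prod.mk_inj.mpr he)
  rw [IsBStarWalk, isBWalk_iff_isPairWalk, hpair]
  simp only [IsPairWalk, Finset.mem_erase]
  grind

lemma sigmaStar_eq_pairWalkCount (n : ℕ) (p : ℤ × ℤ) :
    (sigmaStar (2 * n) p : ℤ) = pairWalkCount (upDownPairs.erase ((1, 0), (-1, 0))) n p := by
  simp only [sigmaStar, pairWalkCount, PairWalk, isBStarWalk_iff_isPairWalk]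

lemma IsPWalk.apply_one {s : ℕ} {w : ℕ → ℤ × ℤ} (hw : IsPWalk W2 (s + 1) w) :
    w 1 = (1, 0) := by
  have h1 := hw.2.1 1 (by omega)
  have hd := hw.2.2.1 1 le_rfl (by omega) rfl
  rw [Nat.sub_self, hw.1] at hd
  generalize w 1 = v at h1 hd
  obtain ⟨a, b⟩ := v
  simp only [W2, Set.mem_ofPred_eq, DownStep, Prod.mk_sub_mk, Prod.mk.injEq] at h1 hd ⊢
  omega

/-- The first step of a `𝒫`-walk in `W2` is forced to be `(0,0)`; deleting it gives a `ℬ`-walk. -/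
lemma IsPWalk.tail {s : ℕ} {w : ℕ → ℤ × ℤ} (hw : IsPWalk W2 (s + 1) w) :
    IsBWalk W2 s (fun r ↦ w (r + 1)) := by
  obtain ⟨-, hW, hd, hu, hc⟩ := id hw
  refine ⟨hw.apply_one, fun r hr ↦ hW _ (by omega), fun r h1 hr hm ↦ ?_, fun r h1 hr hm ↦ ?_,
    fun r hr ↦ hc _ (by omega)⟩
  · simpa [Nat.sub_add_cancel h1] using hu (r + 1) (by omega) (by omega) (by omega)
  · simpa [Nat.sub_add_cancel h1] using hd (r + 1) (by omega) (by omega) (by omega)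

/-- Prepending a stationary step to a `ℬ`-walk gives a `𝒫`-walk. -/
lemma IsBWalk.cons {s : ℕ} {w : ℕ → ℤ × ℤ} (hw : IsBWalk W2 s w) :
    IsPWalk W2 (s + 1) (fun r ↦ w (r - 1)) := by
  obtain ⟨h0, hW, hu, hd, hc⟩ := hw
  refine ⟨h0, fun r hr ↦ hW _ (by omega), fun r h1 hr hm ↦ ?_, fun r h1 hr hm ↦ ?_,
    fun r hr ↦ hc _ (by omega)⟩
  · rcases Nat.eq_or_lt_of_le h1 with rfl | h
    · exact Or.inr (Or.inr (sub_self _))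
    · exact hd (r - 1) (by omega) (by omega) (by omega)
  · exact hu (r - 1) (by omega) (by omega) (by omega)

lemma omegaW_succ_eq_sigmaB (s : ℕ) (p : ℤ × ℤ) : omegaW (s + 1) p = sigmaB s p := by
  refine Nat.card_congr ⟨fun w ↦ ⟨_, w.2.1.tail, w.2.2⟩, fun w ↦ ⟨_, w.2.1.cons, w.2.2⟩,
    fun w ↦ Subtype.ext (funext fun r ↦ ?_), fun w ↦ rfl⟩
  rcases r with _ | r
  · exact w.2.1.apply_one.trans w.2.1.1.symm
  · rfl

lemma omegaW_eq_pairWalkCount (n : ℕ) (p : ℤ × ℤ) :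
    (omegaW (2 * n + 1) p : ℤ) = pairWalkCount upDownPairs n p := by
  simp only [omegaW_succ_eq_sigmaB, sigmaB, pairWalkCount, PairWalk, isBWalk_iff_isPairWalk]

/-- For `ℓ ≥ 0` and `i > j ≥ 0`,
`σ*^{i,j}_{2ℓ} = Σ_{h=0}^{ℓ} (-1)^h C(ℓ,h) ω^{i,j}_{2(ℓ-h)+1}`. -/
theorem sigmaStar_inclusion_exclusion (ℓ : ℕ) (i j : ℤ) (hij : j < i) (hj : 0 ≤ j) :
    (sigmaStar (2 * ℓ) (i, j) : ℤ)
      = ∑ h ∈ Finset.range (ℓ + 1),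
          (-1 : ℤ) ^ h * (Nat.choose ℓ h : ℤ) * (omegaW (2 * (ℓ - h) + 1) (i, j) : ℤ) := by
  simp only [sigmaStar_eq_pairWalkCount, omegaW_eq_pairWalkCount, pairWalkCount_erase_eq_pow]
  have hcomm : Commute (-1) (pairTransfer upDownPairs) := Commute.neg_one_left _
  rw [hcomm.add_pow, LinearMap.sum_apply, Finset.sum_apply]
  refine Finset.sum_congr rfl fun h _ ↦ ?_
  have hscalar : (-1 : Module.End ℤ (ℤ × ℤ → ℤ)) ^ h * pairTransfer upDownPairs ^ (ℓ - h) *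
      (ℓ.choose h : Module.End ℤ (ℤ × ℤ → ℤ)) =
      ((-1 : ℤ) ^ h * (ℓ.choose h : ℤ)) • pairTransfer upDownPairs ^ (ℓ - h) := by
    rw [zsmul_eq_mul, mul_assoc, ← Nat.cast_comm, ← mul_assoc]
    push_cast
    rfl
  rw [hscalar, LinearMap.smul_apply, Pi.smul_apply, smul_eq_mul, ← pairWalkCount_eq_pow]
end
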